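/- Let S be the string rewriting system constructed from a given GPCP instance as described. Then S is confluent: for all strings u, v_1, v_2 ∈ Σ̂*, if u →*_S v_1 and u →*_S v_2, then there exists a string t with v_1 →*_S t and v_2 →*_S t. -/

import Mathlib

/-- The two-letter alphabet Γ = {a, b} of the GPCP instance. -/
inductive Γ : Type where
  | a : Γ
  | b : Γ

/-- The alphabet Σ̂ = {a₁,a₂,a₃,b₁,b₂,b₃,¢₁,¢₂,B} ∪ {c₀,…,c_{n+1}}. -/
inductive Ltr (n : ℕ) : Type where
  | a1 : Ltr n
  | a2 : Ltr n
  | a3 : Ltr n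
  | b1 : Ltr n
  | b2 : Ltr n
  | b3 : Ltr n
  | cent1 : Ltr n
  | cent2 : Ltr n
  | B : Ltr n
  | c : Fin (n + 2) → Ltr n

/-- The homomorphism h₁ : Γ* → Σ̂*, h₁(a) = a₁a₂a₃, h₁(b) = b₁b₂b₃. -/
def h1 {n : ℕ} (w : List Γ) : List (Ltr n) :=
  w.flatMap fun g => match g with
    | Γ.a => [Ltr.a1, Ltr.a2, Ltr.a3]
    | Γ.b => [Ltr.b1, Ltr.b2, Ltr.b3]

/-- The homomorphism h₂ : Γ* → Σ̂*, h₂(a) = a₁a₂, h₂(b) = b₁b₂. -/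
def h2 {n : ℕ} (w : List Γ) : List (Ltr n) :=
  w.flatMap fun g => match g with
    | Γ.a => [Ltr.a1, Ltr.a2]
    | Γ.b => [Ltr.b1, Ltr.b2]

/-- The homomorphism h₃ : Γ* → Σ̂*, h₃(a) = a₁, h₃(b) = b₁. -/
def h3 {n : ℕ} (w : List Γ) : List (Ltr n) :=
  w.flatMap fun g => match g with
    | Γ.a => [Ltr.a1]
    | Γ.b => [Ltr.b1]

/-- One-step rewrite relation of a string rewriting system `R`
(a set of rules `(l, r)`): `u →_R v` iff `u = x l y` and `v = x r y`. -/
def OneStep {α : Type*} (R : Set (List α × List α)) (u v : List α) : Prop :=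
  ∃ x y l r : List α, (l, r) ∈ R ∧ u = x ++ l ++ y ∧ v = x ++ r ++ y

/-- `u →*_R v`: reflexive-transitive closure of the one-step rewrite relation. -/
def RewStar {α : Type*} (R : Set (List α × List α)) : List α → List α → Prop :=
  Relation.ReflTransGen (OneStep R)

/-- `u ↔*_R v`: the Thue congruence, i.e. the reflexive-transitive-symmetric
closure of the one-step rewrite relation. -/
def ThueCong {α : Type*} (R : Set (List α × List α)) : List α → List α → Prop :=
  Relation.EqvGen (OneStep R)

/-- The rules of the string rewriting system `S` constructed from the GPCP
instance with dominoes `(x i, y i)` for `i = 0, …, n+1`. -/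
inductive SRule (n : ℕ) (x y : Fin (n + 2) → List Γ) :
    List (Ltr n) → List (Ltr n) → Prop where
  /- Class D rules -/
  | D1 (g : Γ) : SRule n x y ([Ltr.cent1] ++ h1 [g]) ([Ltr.cent1] ++ h3 [g])
  | D2 (g : Γ) : SRule n x y ([Ltr.cent2] ++ h1 [g]) ([Ltr.cent2] ++ h2 [g])
  | D3 (g g' : Γ) : SRule n x y (h2 [g] ++ h1 [g']) (h2 [g] ++ h2 [g'])
  | D4 (g g' : Γ) : SRule n x y (h3 [g] ++ h1 [g']) (h3 [g] ++ h3 [g'])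
  /- Class I rules -/
  | I1 : SRule n x y ([Ltr.cent1] ++ h3 (x 0) ++ [Ltr.B, Ltr.c 0]) []
  | I2 : SRule n x y ([Ltr.cent2] ++ h2 (y 0) ++ [Ltr.c 0]) []
  /- Class II rules -/
  | II1 (i : Fin (n + 2)) (hi : 1 ≤ (i : ℕ)) (hn : (i : ℕ) ≤ n) :
      SRule n x y (h3 (x i) ++ [Ltr.B, Ltr.c i]) []
  | II2 (i : Fin (n + 2)) (hi : 1 ≤ (i : ℕ)) (hn : (i : ℕ) ≤ n) :
      SRule n x y (h2 (y i) ++ [Ltr.c i, Ltr.B]) []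
  /- Class III rules -/
  | III1 : SRule n x y (h3 (x (Fin.last (n + 1))) ++ [Ltr.c (Fin.last (n + 1))]) []
  | III2 : SRule n x y (h2 (y (Fin.last (n + 1))) ++ [Ltr.c (Fin.last (n + 1)), Ltr.B]) []

/-- The string rewriting system `S` as a set of rules. -/
def SSys (n : ℕ) (x y : Fin (n + 2) → List Γ) : Set (List (Ltr n) × List (Ltr n)) :=
  {p | SRule n x y p.1 p.2}

/-- The GPCP instance `(x i, y i)_{i = 0,…,n+1}` (with start domino index `0`,
end domino index `n+1` and intermediate dominoes `1,…,n`) has a solution: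
a sequence of indices `i₁, …, i_k ∈ {1, …, n}` with
`x₀ x_{i₁} ⋯ x_{i_k} x_{n+1} = y₀ y_{i₁} ⋯ y_{i_k} y_{n+1}`. -/
def GPCPSolvable (n : ℕ) (x y : Fin (n + 2) → List Γ) : Prop :=
  ∃ L : List (Fin (n + 2)), (∀ i ∈ L, 1 ≤ (i : ℕ) ∧ (i : ℕ) ≤ n) ∧
    x 0 ++ L.flatMap x ++ x (Fin.last (n + 1)) =
      y 0 ++ L.flatMap y ++ y (Fin.last (n + 1))

/-- The first letter of `h1 [g]`. -/
def Γ.fst {n : ℕ} : Γ → Ltr n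
  | a => .a1
  | b => .b1

/-- The second letter of `h1 [g]`. -/
def Γ.snd {n : ℕ} : Γ → Ltr n
  | a => .a2
  | b => .b2

/-- The third letter of `h1 [g]`. -/
def Γ.thd {n : ℕ} : Γ → Ltr n
  | a => .a3
  | b => .b3

/-- The letters `a₃`, `b₃` and `cᵢ`, exactly one of which occurs in every left-hand side of `S`. -/
def Ltr.IsMarker {n : ℕ} : Ltr n → Prop
  | a3 => True
  | b3 => True
  | c _ => True
  | _ => False

/-- `MarkedRule n x y p m s r` says that `p m s → r` is a rule of `S` with marker `m`. -/
inductive MarkedRule (n : ℕ) (x y : Fin (n + 2) → List Γ) :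
    List (Ltr n) → Ltr n → List (Ltr n) → List (Ltr n) → Prop where
  | D1 (g : Γ) : MarkedRule n x y [.cent1, g.fst, g.snd] g.thd [] [.cent1, g.fst]
  | D2 (g : Γ) : MarkedRule n x y [.cent2, g.fst, g.snd] g.thd [] [.cent2, g.fst, g.snd]
  | D3 (g g' : Γ) : MarkedRule n x y [g.fst, g.snd, g'.fst, g'.snd] g'.thd []
      [g.fst, g.snd, g'.fst, g'.snd]
  | D4 (g g' : Γ) : MarkedRule n x y [g.fst, g'.fst, g'.snd] g'.thd [] [g.fst, g'.fst]
  | I1 : MarkedRule n x y (.cent1 :: h3 (x 0) ++ [.B]) (.c 0) [] []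
  | I2 : MarkedRule n x y (.cent2 :: h2 (y 0)) (.c 0) [] []
  | II1 (i : Fin (n + 2)) (hi : 1 ≤ (i : ℕ)) (hn : (i : ℕ) ≤ n) :
      MarkedRule n x y (h3 (x i) ++ [.B]) (.c i) [] []
  | II2 (i : Fin (n + 2)) (hi : 1 ≤ (i : ℕ)) (hn : (i : ℕ) ≤ n) :
      MarkedRule n x y (h2 (y i)) (.c i) [.B] []
  | III1 : MarkedRule n x y (h3 (x (Fin.last (n + 1)))) (.c (Fin.last (n + 1))) [] []
  | III2 : MarkedRule n x y (h2 (y (Fin.last (n + 1)))) (.c (Fin.last (n + 1))) [.B] []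

theorem h1_singleton {n : ℕ} (g : Γ) : (h1 [g] : List (Ltr n)) = [g.fst, g.snd, g.thd] := by
  cases g <;> rfl

theorem h2_singleton {n : ℕ} (g : Γ) : (h2 [g] : List (Ltr n)) = [g.fst, g.snd] := by
  cases g <;> rfl

theorem h3_singleton {n : ℕ} (g : Γ) : (h3 [g] : List (Ltr n)) = [g.fst] := by
  cases g <;> rfl

theorem h2_cons {n : ℕ} (g : Γ) (w : List Γ) :
    (h2 (g :: w) : List (Ltr n)) = g.fst :: g.snd :: h2 w := by
  cases g <;> rfl

theorem h3_cons {n : ℕ} (g : Γ) (w : List Γ) :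
    (h3 (g :: w) : List (Ltr n)) = g.fst :: h3 w := by
  cases g <;> rfl

theorem getLast?_h2 {n : ℕ} {w : List Γ} (hw : w ≠ []) :
    ∃ g : Γ, (h2 w : List (Ltr n)).getLast? = some g.snd := by
  obtain ⟨v, g, rfl⟩ := (List.eq_nil_or_concat w).resolve_left hw
  exact ⟨g, by cases g <;> simp [h2, Γ.snd]⟩

theorem getLast?_h3 {n : ℕ} {w : List Γ} (hw : w ≠ []) :
    ∃ g : Γ, (h3 w : List (Ltr n)).getLast? = some g.fst := by
  obtain ⟨v, g, rfl⟩ := (List.eq_nil_or_concat w).resolve_left hw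
  exact ⟨g, by cases g <;> simp [h3, Γ.fst]⟩

theorem not_isMarker_of_mem_h2 {n : ℕ} {w : List Γ} {a : Ltr n} (ha : a ∈ h2 w) :
    ¬ a.IsMarker := by
  obtain ⟨g, -, hg⟩ := List.mem_flatMap.1 ha
  cases g <;> simp at hg <;> rcases hg with rfl | rfl <;> exact id

theorem not_isMarker_of_mem_h3 {n : ℕ} {w : List Γ} {a : Ltr n} (ha : a ∈ h3 w) :
    ¬ a.IsMarker := by
  obtain ⟨g, -, hg⟩ := List.mem_flatMap.1 ha
  cases g <;> simp at hg <;> subst hg <;> exact id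

theorem head?_h2_append_ne_B {n : ℕ} {w : List Γ} (hw : w ≠ []) (v : List (Ltr n)) :
    (h2 w ++ v).head? ≠ some .B := by
  obtain ⟨g, w, rfl⟩ := List.exists_cons_of_ne_nil hw
  cases g <;> simp [h2_cons, Γ.fst]

theorem head?_h3_append_ne_B {n : ℕ} {w : List Γ} (hw : w ≠ []) (v : List (Ltr n)) :
    (h3 w ++ v).head? ≠ some .B := by
  obtain ⟨g, w, rfl⟩ := List.exists_cons_of_ne_nil hw
  cases g <;> simp [h3_cons, Γ.fst]

section MarkedRule

variable {n : ℕ} {x y : Fin (n + 2) → List Γ}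
  {p p' s s' r r' : List (Ltr n)} {m m' : Ltr n}

theorem MarkedRule.isMarker (h : MarkedRule n x y p m s r) : m.IsMarker := by
  cases h
  case D1 g | D2 g => cases g <;> trivial
  case D3 _ g | D4 _ g => cases g <;> trivial
  all_goals trivial

theorem MarkedRule.not_isMarker (h : MarkedRule n x y p m s r) :
    ∀ a ∈ p, ¬ a.IsMarker := by
  cases h
  case D1 g | D2 g => cases g <;> simp [Γ.fst, Γ.snd, Ltr.IsMarker]
  case D3 g g' | D4 g g' => cases g <;> cases g' <;> simp [Γ.fst, Γ.snd, Ltr.IsMarker]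
  all_goals
    intro a ha
    have h2' := @not_isMarker_of_mem_h2 n
    have h3' := @not_isMarker_of_mem_h3 n
    grind [Ltr.IsMarker]

theorem MarkedRule.suffix_eq (h : MarkedRule n x y p m s r) : s = [] ∨ s = [.B] := by
  cases h <;> simp

theorem MarkedRule.head?_ne_B (hx : ∀ i, x i ≠ []) (hy : ∀ i, y i ≠ [])
    (h : MarkedRule n x y p m s r) : p.head? ≠ some .B := by
  cases h
  case D1 | D2 | I1 | I2 => simp
  case D3 g _ | D4 g _ => cases g <;> simp [Γ.fst]
  case II1 i _ _ => exact head?_h3_append_ne_B (hx i) _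
  case III1 => simpa using head?_h3_append_ne_B (hx (Fin.last (n + 1))) []
  case II2 i _ _ => simpa using head?_h2_append_ne_B (hy i) []
  case III2 => simpa using head?_h2_append_ne_B (hy (Fin.last (n + 1))) []

theorem MarkedRule.sRule (h : MarkedRule n x y p m s r) : SRule n x y (p ++ m :: s) r := by
  cases h
  case D1 g => simpa [h1_singleton, h3_singleton] using SRule.D1 (x := x) (y := y) g
  case D2 g => simpa [h1_singleton, h2_singleton] using SRule.D2 (x := x) (y := y) g
  case D3 g g' => simpa [h1_singleton, h2_singleton] using SRule.D3 (x := x) (y := y) g g'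
  case D4 g g' => simpa [h1_singleton, h3_singleton] using SRule.D4 (x := x) (y := y) g g'
  case I1 => simpa using SRule.I1 (n := n) (x := x) (y := y)
  case I2 => exact SRule.I2
  case II1 i hi hn => simpa using SRule.II1 (x := x) (y := y) i hi hn
  case II2 i hi hn => exact SRule.II2 i hi hn
  case III1 => exact SRule.III1
  case III2 => exact SRule.III2

theorem SRule.exists_markedRule {l : List (Ltr n)} (h : SRule n x y l r) :
    ∃ p m s, l = p ++ m :: s ∧ MarkedRule n x y p m s r := by
  cases h
  case D1 g =>
    refine ⟨[.cent1, g.fst, g.snd], g.thd, [], by simp [h1_singleton], ?_⟩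
    simpa [h3_singleton] using MarkedRule.D1 (x := x) (y := y) g
  case D2 g =>
    refine ⟨[.cent2, g.fst, g.snd], g.thd, [], by simp [h1_singleton], ?_⟩
    simpa [h2_singleton] using MarkedRule.D2 (x := x) (y := y) g
  case D3 g g' =>
    refine ⟨[g.fst, g.snd, g'.fst, g'.snd], g'.thd, [], by simp [h1_singleton, h2_singleton], ?_⟩
    simpa [h2_singleton] using MarkedRule.D3 (x := x) (y := y) g g'
  case D4 g g' =>
    refine ⟨[g.fst, g'.fst, g'.snd], g'.thd, [], by simp [h1_singleton, h3_singleton], ?_⟩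
    simpa [h3_singleton] using MarkedRule.D4 (x := x) (y := y) g g'
  case I1 => exact ⟨_, _, _, by simp, .I1⟩
  case I2 => exact ⟨_, _, _, rfl, .I2⟩
  case II1 i hi hn => exact ⟨_, _, _, by simp, .II1 i hi hn⟩
  case II2 i hi hn => exact ⟨_, _, _, rfl, .II2 i hi hn⟩
  case III1 => exact ⟨_, _, _, rfl, .III1⟩
  case III2 => exact ⟨_, _, _, rfl, .III2⟩

theorem MarkedRule.eq_of_suffix (hx : ∀ i, x i ≠ []) (hy : ∀ i, y i ≠ [])
    (h : MarkedRule n x y p m s r) (h' : MarkedRule n x y p' m' s' r') (hm : m' = m)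
    (hp : p' <:+ p) : p' = p ∧ s' = s ∧ r' = r := by
  have hlast (a : Ltr n) (ha : p'.getLast? = some a) : p.getLast? = some a := by
    obtain ⟨t, rfl⟩ := hp
    simp [ha]
  choose gx hgx using fun i => getLast?_h3 (n := n) (hx i)
  choose gy hgy using fun i => getLast?_h2 (n := n) (hy i)
  have hB (g : Γ) : .B ≠ (g.snd : Ltr n) := by cases g <;> simp [Γ.snd]
  have hfs (g g' : Γ) : g.fst ≠ (g'.snd : Ltr n) := by
    cases g <;> cases g' <;> simp [Γ.fst, Γ.snd]
  have hc (g : Γ) (i) : g.thd ≠ (.c i : Ltr n) := by cases g <;> simp [Γ.thd]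
  have hthd (g g' : Γ) (hg : g.thd = (g'.thd : Ltr n)) : g = g' := by
    cases g <;> cases g' <;> simp_all [Γ.thd]
  have hfst (g g' : Γ) : g.fst = (g'.fst : Ltr n) ↔ g = g' := by
    cases g <;> cases g' <;> simp [Γ.fst]
  have hcent (g : Γ) : (.cent1 ≠ (g.fst : Ltr n) ∧ .cent2 ≠ (g.fst : Ltr n)) ∧
      .cent1 ≠ (g.snd : Ltr n) ∧ .cent2 ≠ (g.snd : Ltr n) := by
    cases g <;> simp [Γ.fst, Γ.snd]
  clear hx hy
  cases h <;> cases h'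
  all_goals try simp only [Ltr.c.injEq, hc, (hc _ _).symm] at hm
  all_goals try subst hm
  all_goals try obtain rfl := hthd _ _ hm
  all_goals
    simp_all [List.suffix_cons_iff, List.getLast?_cons, (hB _).symm, (hfs _ _).symm,
      (hcent _).1.2.symm]

theorem MarkedRule.eq_of_aligned (hx : ∀ i, x i ≠ []) (hy : ∀ i, y i ≠ [])
    (h : MarkedRule n x y p m s r) (h' : MarkedRule n x y p' m' s' r') (hm : m' = m)
    {e f e' f' : List (Ltr n)} (hl : e ++ p = e' ++ p') (hr : s ++ f = s' ++ f') :
    e ++ r ++ f = e' ++ r' ++ f' := by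
  obtain ⟨rfl, rfl, rfl⟩ : p' = p ∧ s' = s ∧ r' = r := by
    rcases List.suffix_or_suffix_of_suffix (List.suffix_append e p) ⟨e', hl.symm⟩ with hp | hp
    · obtain ⟨h1, h2, h3⟩ := h'.eq_of_suffix hx hy h hm.symm hp
      exact ⟨h1.symm, h2.symm, h3.symm⟩
    · exact h.eq_of_suffix hx hy h' hm hp
  rw [List.append_cancel_right hl, List.append_cancel_left hr]

theorem MarkedRule.join_of_lt (hx : ∀ i, x i ≠ []) (hy : ∀ i, y i ≠ [])
    (h : MarkedRule n x y p m s r) (h' : MarkedRule n x y p' m' s' r')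
    {e f e' f' w : List (Ltr n)} (hl : e ++ p ++ m :: w = e' ++ p')
    (hr : s ++ f = w ++ m' :: (s' ++ f')) :
    ∃ t, OneStep (SSys n x y) (e ++ r ++ f) t ∧ OneStep (SSys n x y) (e' ++ r' ++ f') t := by
  have hpw : p' <:+ w := by
    have h1 : p' <:+ e ++ p ++ m :: w := ⟨e', hl.symm⟩
    have h2 : w <:+ e ++ p ++ m :: w := ⟨e ++ p ++ [m], by simp⟩
    rcases List.suffix_or_suffix_of_suffix h1 h2 with h3 | ⟨_ | ⟨a, q⟩, h3⟩
    · exact h3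
    · exact ⟨[], by simpa using h3.symm⟩
    · have h4 : m ∈ p' := by
        have h5 : m :: w <:+ p' := by
          refine List.suffix_of_suffix_length_le ⟨e ++ p, rfl⟩ h1 ?_
          simp [← h3]
        exact h5.subset (by simp)
      exact absurd h.isMarker (h'.not_isMarker m h4)
  obtain ⟨z, hz, hf⟩ : ∃ z, w = s ++ z ++ p' ∧ f = z ++ p' ++ m' :: (s' ++ f') := by
    obtain ⟨z, rfl⟩ := hpw
    rcases h.suffix_eq with rfl | rfl
    · exact ⟨z, by simp, by simpa using hr⟩
    · rcases z with _ | ⟨a, z⟩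
      · rcases p' with _ | ⟨a, p'⟩
        · have := h'.isMarker
          simp at hr
          simp [← hr.1, Ltr.IsMarker] at this
        · simp at hr
          exact absurd (by simp [← hr.1]) (h'.head?_ne_B hx hy)
      · simp at hr
        exact ⟨z, by simp [hr.1], by simpa using hr.2⟩
  subst hz hf
  have he' : e' = e ++ p ++ m :: (s ++ z) := by
    apply List.append_cancel_right (bs := p')
    simpa using hl.symm
  subst he'
  exact ⟨e ++ r ++ z ++ r' ++ f',
    ⟨e ++ r ++ z, f', _, _, h'.sRule, by simp, by simp⟩,
    ⟨e, z ++ r' ++ f', _, _, h.sRule, by simp, by simp⟩⟩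

theorem oneStep_SSys_diamond (hx : ∀ i, x i ≠ []) (hy : ∀ i, y i ≠ [])
    {u v v' : List (Ltr n)} (h : OneStep (SSys n x y) u v) (h' : OneStep (SSys n x y) u v') :
    v = v' ∨ ∃ t, OneStep (SSys n x y) v t ∧ OneStep (SSys n x y) v' t := by
  obtain ⟨e, f, l, r, hl, rfl, rfl⟩ := h
  obtain ⟨e', f', l', r', hl', hu, rfl⟩ := h'
  obtain ⟨p, m, s, rfl, hm⟩ := SRule.exists_markedRule hl
  obtain ⟨p', m', s', rfl, hm'⟩ := SRule.exists_markedRule hl'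
  have hu' : (e ++ p) ++ m :: (s ++ f) = (e' ++ p') ++ m' :: (s' ++ f') := by simpa using hu
  rcases List.append_eq_append_iff.1 hu' with ⟨_ | ⟨a, w⟩, h1, h2⟩ | ⟨_ | ⟨a, w⟩, h1, h2⟩
  · simp only [List.nil_append, List.append_nil, List.cons.injEq] at h1 h2
    exact .inl (hm.eq_of_aligned hx hy hm' h2.1.symm h1.symm h2.2)
  · obtain ⟨rfl, h3⟩ := List.cons.inj h2
    exact .inr (hm.join_of_lt hx hy hm' h1.symm h3)
  · simp only [List.nil_append, List.append_nil, List.cons.injEq] at h1 h2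
    exact .inl (hm.eq_of_aligned hx hy hm' h2.1 h1 h2.2.symm)
  · obtain ⟨rfl, h3⟩ := List.cons.inj h2
    obtain ⟨t, ht, ht'⟩ := hm'.join_of_lt hx hy hm h1.symm h3
    exact .inr ⟨t, ht', ht⟩

end MarkedRule

/-- The system `S` is confluent. -/
theorem S_confluent (n : ℕ) (x y : Fin (n + 2) → List Γ)
    (hx : ∀ i, x i ≠ []) (hy : ∀ i, y i ≠ []) :
    ∀ u v1 v2 : List (Ltr n), RewStar (SSys n x y) u v1 →
      RewStar (SSys n x y) u v2 →
      ∃ t : List (Ltr n), RewStar (SSys n x y) v1 t ∧ RewStar (SSys n x y) v2 t := by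
  intro u v1 v2 h1 h2
  refine Relation.church_rosser (fun a b c hb hc => ?_) h1 h2
  rcases oneStep_SSys_diamond hx hy hb hc with rfl | ⟨t, hbt, hct⟩
  · exact ⟨b, .refl, .refl⟩
  · exact ⟨t, .single hbt, .single hct⟩
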